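/- arXiv:1701.08093 — 2 statements merged into one kernel-verified Lean document; each statement's English description precedes it below -/
import Mathlib

section
/- Let h, p, u, v : ℝ × ℝ² → ℝ be C¹ with h > 0 and p ≠ 0 everywhere, f, g ∈ ℝ, T > 0. Define Ψ(p) = −f·g/(2p) and relative vorticity ζ = ∂_x v − ∂_y u. Assume the continuity equation ∂_t h + ∂_x(h u) + ∂_y(h v) = 0 and the Ekman-damped potential-vorticity equation ∂_t p + u·∂_x p + v·∂_y p = −ζ/(T·h). Then at every point: ∂_t(h·Ψ(p)) + ∂_x(h·Ψ(p)·u) + ∂_y(h·Ψ(p)·v) = −(f·g/(2p²))·ζ/T. -/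
/-- Partial derivative with respect to time `t` of a function on `ℝ × ℝ²` (arguments `(t,x,y)`). -/
noncomputable def pdt (f : ℝ × ℝ × ℝ → ℝ) (q : ℝ × ℝ × ℝ) : ℝ :=
  deriv (fun s => f (s, q.2)) q.1

/-- Partial derivative with respect to `x` of a function on `ℝ × ℝ²` (arguments `(t,x,y)`). -/
noncomputable def pdx (f : ℝ × ℝ × ℝ → ℝ) (q : ℝ × ℝ × ℝ) : ℝ :=
  deriv (fun s => f (q.1, s, q.2.2)) q.2.1

/-- Partial derivative with respect to `y` of a function on `ℝ × ℝ²` (arguments `(t,x,y)`). -/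
noncomputable def pdy (f : ℝ × ℝ × ℝ → ℝ) (q : ℝ × ℝ × ℝ) : ℝ :=
  deriv (fun s => f (q.1, q.2.1, s)) q.2.2

/-- One-variable product and chain rule for `a · Ψ(b)`. -/
theorem deriv_mul_casimir (f g : ℝ) (Ψ : ℝ → ℝ) (hΨ : ∀ s : ℝ, Ψ s = -(f * g) / (2 * s))
    (a b : ℝ → ℝ) (x : ℝ) (ha : DifferentiableAt ℝ a x) (hb : DifferentiableAt ℝ b x)
    (hne : b x ≠ 0) :
    deriv (fun s => a s * Ψ (b s)) x
      = deriv a x * Ψ (b x) + a x * (f * g / (2 * b x ^ 2) * deriv b x) := by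
  have h1 : HasDerivAt (fun s => Ψ (b s)) (f * g / (2 * b x ^ 2) * deriv b x) x := by
    have h2 := (hasDerivAt_const x (-(f * g))).fun_div (hb.hasDerivAt.const_mul 2)
      (mul_ne_zero two_ne_zero hne)
    simp only [hΨ]
    refine h2.congr_deriv ?_
    field_simp
    ring
  exact (ha.hasDerivAt.mul h1).deriv

/-- Let `h, p, u, v : ℝ × ℝ² → ℝ` be C¹ with `h > 0` and `p ≠ 0` everywhere,
`f, g ∈ ℝ`, `T > 0`. Define `Ψ(p) = −f·g/(2p)` and relative vorticity `ζ = ∂_x v − ∂_y u`.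
Assume the continuity equation `∂_t h + ∂_x(h u) + ∂_y(h v) = 0` and the Ekman-damped
potential-vorticity equation `∂_t p + u·∂_x p + v·∂_y p = −ζ/(T·h)`. Then at every point:
`∂_t(h·Ψ(p)) + ∂_x(h·Ψ(p)·u) + ∂_y(h·Ψ(p)·v) = −(f·g/(2p²))·ζ/T`. -/
theorem stmt6 (h p u v : ℝ × ℝ × ℝ → ℝ) (f g T : ℝ) (hT : 0 < T)
    (hh : ContDiff ℝ 1 h) (hp : ContDiff ℝ 1 p) (hu : ContDiff ℝ 1 u) (hv : ContDiff ℝ 1 v)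
    (hpos : ∀ q, 0 < h q) (hpne : ∀ q, p q ≠ 0)
    (Ψ : ℝ → ℝ) (hΨ : ∀ s : ℝ, Ψ s = -(f * g) / (2 * s))
    (ζ : ℝ × ℝ × ℝ → ℝ) (hζ : ∀ q, ζ q = pdx v q - pdy u q)
    (hcont : ∀ q, pdt h q + pdx (fun r => h r * u r) q + pdy (fun r => h r * v r) q = 0)
    (hpv : ∀ q, pdt p q + u q * pdx p q + v q * pdy p q = -ζ q / (T * h q)) :
    ∀ q, pdt (fun r => h r * Ψ (p r)) q
        + pdx (fun r => h r * Ψ (p r) * u r) q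
        + pdy (fun r => h r * Ψ (p r) * v r) q
      = -(f * g / (2 * p q ^ 2)) * ζ q / T := by
  intro q
  have dh := hh.differentiable one_ne_zero
  have dp := hp.differentiable one_ne_zero
  have du := hu.differentiable one_ne_zero
  have dv := hv.differentiable one_ne_zero
  have e1 : pdt (fun r => h r * Ψ (p r)) q
      = pdt h q * Ψ (p q) + h q * (f * g / (2 * p q ^ 2) * pdt p q) :=
    deriv_mul_casimir f g Ψ hΨ (fun s => h (s, q.2)) (fun s => p (s, q.2)) q.1
      (by fun_prop) (by fun_prop) (hpne _)
  have e2 : pdx (fun r => h r * Ψ (p r) * u r) q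
      = pdx (fun r => h r * u r) q * Ψ (p q)
        + h q * u q * (f * g / (2 * p q ^ 2) * pdx p q) := by
    simp only [mul_right_comm (h _) (Ψ _)]
    exact deriv_mul_casimir f g Ψ hΨ (fun s => h (q.1, s, q.2.2) * u (q.1, s, q.2.2))
      (fun s => p (q.1, s, q.2.2)) q.2.1 (by fun_prop) (by fun_prop) (hpne _)
  have e3 : pdy (fun r => h r * Ψ (p r) * v r) q
      = pdy (fun r => h r * v r) q * Ψ (p q)
        + h q * v q * (f * g / (2 * p q ^ 2) * pdy p q) := by
    simp only [mul_right_comm (h _) (Ψ _)]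
    exact deriv_mul_casimir f g Ψ hΨ (fun s => h (q.1, q.2.1, s) * v (q.1, q.2.1, s))
      (fun s => p (q.1, q.2.1, s)) q.2.2 (by fun_prop) (by fun_prop) (hpne _)
  have hhq := (hpos q).ne'
  have key : h q * (-ζ q / (T * h q)) = -ζ q / T := by
    field_simp
  rw [← hpv q] at key
  rw [e1, e2, e3]
  linear_combination Ψ (p q) * hcont q + f * g / (2 * p q ^ 2) * key
end

section
/- Let f ≠ 0, b₀ ∈ ℝ, and let F₀ : ℝ → ℝ be C¹ on an interval I ⊆ (0,∞) with F₀(p) ≠ 0 on I; fix p₁ ∈ I. Define, for (b,p) ∈ ℝ × I: y(b,p) = f⁻¹·∫_{p₁}^{p} s·F₀(s) ds, Z(b,p) = f·(b − b₀)/p, and v(b,p) = f·(b − b₀)²/(2p²) · (p·F₀(p))⁻¹. Then at every (b,p) with p in the interior of I: (a) f·∂_p y = p·F₀(p); (b) ∂_b Z·∂_p y − ∂_p Z·∂_b y = F₀(p); (c) ∂_p v·∂_b y − ∂_b v·∂_p y = f⁻¹·∂_p Z. -/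
/-- Partial derivative with respect to `b` of a function on `ℝ²` (arguments `(b,p)`). -/
noncomputable def pdb (f : ℝ × ℝ → ℝ) (q : ℝ × ℝ) : ℝ :=
  deriv (fun s => f (s, q.2)) q.1

/-- Partial derivative with respect to `p` of a function on `ℝ²` (arguments `(b,p)`). -/
noncomputable def pdp (f : ℝ × ℝ → ℝ) (q : ℝ × ℝ) : ℝ :=
  deriv (fun s => f (q.1, s)) q.2

/-- Let `f ≠ 0`, `b₀ ∈ ℝ`, and let `F₀ : ℝ → ℝ` be C¹ on an interval
`I ⊆ (0,∞)` with `F₀(p) ≠ 0` on `I`; fix `p₁ ∈ I`. Define, for `(b,p) ∈ ℝ × I`: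
`y(b,p) = f⁻¹·∫_{p₁}^{p} s·F₀(s) ds`, `Z(b,p) = f·(b − b₀)/p`, and
`v(b,p) = f·(b − b₀)²/(2p²) · (p·F₀(p))⁻¹`. Then at every `(b,p)` with `p` in the interior
of `I`: (a) `f·∂_p y = p·F₀(p)`; (b) `∂_b Z·∂_p y − ∂_p Z·∂_b y = F₀(p)`;
(c) `∂_p v·∂_b y − ∂_b v·∂_p y = f⁻¹·∂_p Z`. -/
theorem stmt12 (f b₀ : ℝ) (hf : f ≠ 0) (I : Set ℝ) (hI : I ⊆ Set.Ioi (0 : ℝ))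
    (hconn : I.OrdConnected) (F₀ : ℝ → ℝ) (hF : ContDiffOn ℝ 1 F₀ I)
    (hFne : ∀ p ∈ I, F₀ p ≠ 0) (p₁ : ℝ) (hp₁ : p₁ ∈ I)
    (y Z v : ℝ × ℝ → ℝ)
    (hy : ∀ q : ℝ × ℝ, y q = f⁻¹ * ∫ s in p₁..q.2, s * F₀ s)
    (hZ : ∀ q : ℝ × ℝ, Z q = f * (q.1 - b₀) / q.2)
    (hv : ∀ q : ℝ × ℝ, v q = f * (q.1 - b₀) ^ 2 / (2 * q.2 ^ 2) * (q.2 * F₀ q.2)⁻¹) :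
    ∀ b : ℝ, ∀ p ∈ interior I,
      f * pdp y (b, p) = p * F₀ p ∧
      pdb Z (b, p) * pdp y (b, p) - pdp Z (b, p) * pdb y (b, p) = F₀ p ∧
      pdp v (b, p) * pdb y (b, p) - pdb v (b, p) * pdp y (b, p) = f⁻¹ * pdp Z (b, p) := by
  intro b p hp
  have hpI : p ∈ I := interior_subset hp
  have hp0 : p ≠ 0 := ne_of_gt (hI hpI)
  have hFp : F₀ p ≠ 0 := hFne p hpI
  have hc : ContinuousOn (fun s => s * F₀ s) I := continuousOn_id.mul hF.continuousOn
  have hint : IntervalIntegrable (fun s => s * F₀ s) MeasureTheory.volume p₁ p :=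
    (hc.mono (hconn.uIcc_subset hp₁ hpI)).intervalIntegrable
  have hci : ContinuousOn (fun s => s * F₀ s) (interior I) := hc.mono interior_subset
  have hmeas : StronglyMeasurableAtFilter (fun s => s * F₀ s) (nhds p) MeasureTheory.volume :=
    hci.stronglyMeasurableAtFilter isOpen_interior p hp
  have hcp : ContinuousAt (fun s => s * F₀ s) p :=
    hci.continuousAt (isOpen_interior.mem_nhds hp)
  have h1 : pdp y (b, p) = f⁻¹ * (p * F₀ p) := by
    simp only [pdp, hy]
    exact ((intervalIntegral.integral_hasDerivAt_right hint hmeas hcp).const_mul f⁻¹).deriv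
  have h2 : pdb y (b, p) = 0 := by
    simp only [pdb, hy]
    exact deriv_const _ _
  have h3 : pdb Z (b, p) = f / p := by
    simp only [pdb, hZ]
    have := ((((hasDerivAt_id b).sub_const b₀).const_mul f).div_const p).deriv
    simpa using this
  have h4 : pdp Z (b, p) = -(f * (b - b₀)) / p ^ 2 := by
    simp only [pdp, hZ]
    have := ((hasDerivAt_const p (f * (b - b₀))).div (hasDerivAt_id p) hp0).deriv
    refine Eq.trans this ?_
    simp
  have h5 : pdb v (b, p) = f * (2 * (b - b₀)) / (2 * p ^ 2) * (p * F₀ p)⁻¹ := by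
    simp only [pdb, hv]
    have := ((((((hasDerivAt_id b).sub_const b₀).pow 2).const_mul f).div_const
      (2 * p ^ 2)).mul_const (p * F₀ p)⁻¹).deriv
    refine Eq.trans this ?_
    simp
  rw [h1, h2, h3, h4, h5]
  refine ⟨?_, ?_, ?_⟩
  · field_simp
  · field_simp
    try ring
  · field_simp
    try ring
end
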